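/- Assume n ≥ 2 and ‖z̄ − h̄‖₂ ≤ δ√n for some δ ∈ [0,1]. If z̄ is orthogonal to N(H) and λ < 1/(4k), then (TRS) has a unique global minimizer ĝ, and it satisfies (1/n)⟨h̄, ĝ⟩ ≥ 1 − 3δ/2 − λπ²M²(2k)^{2α+1}/n^{2α} + (1/(1 + 4λk − 4λk·sin²(π/(2n)))²)·(1/(2n))·z̄ᵀHz̄. -/

import Mathlib

open scoped BigOperators
noncomputable section

namespace ModOne

/-- Grid points `x_i = (i-1)/(n-1)`, with `i : Fin n` zero-indexed. -/
def gridPt (n : ℕ) (i : Fin n) : ℝ := (i : ℝ) / ((n : ℝ) - 1)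

/-- Adjacency of the path-power graph: `i ≠ j` and `|i − j| ≤ k`. -/
def adj (n k : ℕ) (i j : Fin n) : Prop := i ≠ j ∧ |(i : ℤ) - (j : ℤ)| ≤ (k : ℤ)

instance adjDec (n k : ℕ) (i : Fin n) : DecidablePred (adj n k i) := fun j =>
  inferInstanceAs (Decidable (i ≠ j ∧ |(i : ℤ) - (j : ℤ)| ≤ (k : ℤ)))

/-- Degree of vertex `i` in the graph `G`. -/
def deg (n k : ℕ) (i : Fin n) : ℕ := (Finset.univ.filter (adj n k i)).card

/-- The graph Laplacian `L` of `G`. -/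
def lap (n k : ℕ) : Matrix (Fin n) (Fin n) ℝ := fun i j =>
  if i = j then (deg n k i : ℝ) else if adj n k i j then -1 else 0

/-- The block-diagonal matrix `H` with both diagonal blocks equal to `λL`. -/
def Hmat (n k : ℕ) (lam : ℝ) : Matrix (Fin n ⊕ Fin n) (Fin n ⊕ Fin n) ℝ :=
  Matrix.fromBlocks (lam • lap n k) 0 0 (lam • lap n k)

/-- The angular embedding `circ t = exp(2πι t)`. -/
def circ (t : ℝ) : ℂ := Complex.exp (2 * Real.pi * Complex.I * (t : ℂ))

/-- Real representation `(Re v, Im v) ∈ ℝ^{2n}` of a complex vector `v ∈ ℂ^n`. -/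
def embed (n : ℕ) (v : Fin n → ℂ) : Fin n ⊕ Fin n → ℝ :=
  Sum.elim (fun i => (v i).re) (fun i => (v i).im)

/-- Real representation of the angular embedding of a vector of values `t : Fin n → ℝ`. -/
def cvec (n : ℕ) (t : Fin n → ℝ) : Fin n ⊕ Fin n → ℝ := embed n (fun i => circ (t i))

/-- Quadratic form `vᵀ A v`. -/
def quad (n : ℕ) (A : Matrix (Fin n ⊕ Fin n) (Fin n ⊕ Fin n) ℝ) (v : Fin n ⊕ Fin n → ℝ) : ℝ :=
  ∑ i, v i * A.mulVec v i

/-- Euclidean inner product on `ℝ^{2n}`. -/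
def dotR (n : ℕ) (u v : Fin n ⊕ Fin n → ℝ) : ℝ := ∑ i, u i * v i

/-- Euclidean norm on `ℝ^{2n}`. -/
def norm2 (n : ℕ) (v : Fin n ⊕ Fin n → ℝ) : ℝ := Real.sqrt (∑ i, (v i) ^ 2)

/-- Feasibility for (TRS): `‖g‖₂² = n`. -/
def feasible (n : ℕ) (g : Fin n ⊕ Fin n → ℝ) : Prop := ∑ i, (g i) ^ 2 = (n : ℝ)

/-- The (TRS) objective `ḡᵀHḡ − 2ḡᵀz̄`. -/
def objective (n k : ℕ) (lam : ℝ) (zbar g : Fin n ⊕ Fin n → ℝ) : ℝ :=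
  quad n (Hmat n k lam) g - 2 * dotR n g zbar

/-- `g` is a global minimizer of (TRS) with data `z̄`. -/
def minimizer (n k : ℕ) (lam : ℝ) (zbar g : Fin n ⊕ Fin n → ℝ) : Prop :=
  feasible n g ∧ ∀ g', feasible n g' → objective n k lam zbar g ≤ objective n k lam zbar g'

/-- `z̄` is orthogonal to the null space `N(H)` of `H`. -/
def perpNull (n k : ℕ) (lam : ℝ) (z : Fin n ⊕ Fin n → ℝ) : Prop :=
  ∀ v, (Hmat n k lam).mulVec v = 0 → dotR n z v = 0

end ModOne

namespace Matrix

/-- On a sphere through `z`, the stationarity equation `(A + μ) g = z` of the trust-region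
subproblem is solvable with `0 < μ ≤ 1`, provided the spectrum of `A` lies in `[0, C]`, `C < 1`. -/
theorem exists_trustRegion_solution {ι : Type*} [Fintype ι] [DecidableEq ι] (A : Matrix ι ι ℝ)
    (hA : A.IsHermitian) {C : ℝ} (hC : C < 1) (h0 : ∀ v, 0 ≤ v ⬝ᵥ A *ᵥ v)
    (h1 : ∀ v, v ⬝ᵥ A *ᵥ v ≤ C * (v ⬝ᵥ v)) (z : ι → ℝ) :
    ∃ (g : ι → ℝ) (μ : ℝ), 0 < μ ∧ μ ≤ 1 ∧ A *ᵥ g + μ • g = z ∧ g ⬝ᵥ g = z ⬝ᵥ z ∧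
      z ⬝ᵥ A *ᵥ z ≤ (1 + C) ^ 2 * (g ⬝ᵥ A *ᵥ g) := by
  set e := hA.eigenvalues
  set U : Matrix ι ι ℝ := (hA.eigenvectorUnitary : Matrix ι ι ℝ)
  have hUU : Uᵀ * U = 1 := by
    have := Unitary.coe_star_mul_self hA.eigenvectorUnitary
    simpa [star_eq_conjTranspose, conjTranspose_eq_transpose_of_trivial] using this
  have hUU' : U * Uᵀ = 1 := mul_eq_one_comm.mp hUU
  have hAU : A * U = U * diagonal e := by
    have := hA.spectral_theorem
    rw [Unitary.conjStarAlgAut_apply] at this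
    have h2 : A = U * diagonal e * Uᵀ := by
      simpa [star_eq_conjTranspose, conjTranspose_eq_transpose_of_trivial, Function.comp_def]
        using this
    rw [h2, mul_assoc, hUU, mul_one]
  have hdot (a b : ι → ℝ) : (U *ᵥ a) ⬝ᵥ (U *ᵥ b) = a ⬝ᵥ b := by
    rw [dotProduct_mulVec, ← mulVec_transpose, mulVec_mulVec, hUU, one_mulVec]
  have hmul (a : ι → ℝ) : A *ᵥ (U *ᵥ a) = U *ᵥ (e * a) := by
    rw [mulVec_mulVec, hAU, ← mulVec_mulVec]
    congr 1
    ext i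
    simp [mulVec_diagonal]
  have hquad (a : ι → ℝ) : (U *ᵥ a) ⬝ᵥ A *ᵥ (U *ᵥ a) = ∑ i, e i * a i ^ 2 := by
    rw [hmul, hdot]
    exact Finset.sum_congr rfl fun i _ => by simp [Pi.mul_apply]; ring
  have hsq (a : ι → ℝ) : (U *ᵥ a) ⬝ᵥ (U *ᵥ a) = ∑ i, a i ^ 2 := by
    rw [hdot]
    exact Finset.sum_congr rfl fun i _ => by ring
  have he0 (i : ι) : 0 ≤ e i := by
    have := h0 (U *ᵥ Pi.single i 1)
    rw [hquad] at this
    simpa [Pi.single_apply] using this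
  have heC (i : ι) : e i ≤ C := by
    have := h1 (U *ᵥ Pi.single i 1)
    rw [hquad, hsq] at this
    simpa [Pi.single_apply] using this
  set c := Uᵀ *ᵥ z with hc
  have hz : U *ᵥ c = z := by rw [hc, mulVec_mulVec, hUU', one_mulVec]
  have hpos (μ : ℝ) (hμ : μ ∈ Set.Icc (1 - C) 1) (i : ι) : 0 < e i + μ := by
    have := he0 i
    have := hμ.1
    linarith
  have hcont : ContinuousOn (fun μ => ∑ i, (c i / (e i + μ)) ^ 2) (Set.Icc (1 - C) 1) := by
    refine continuousOn_finsetSum _ fun i _ => ContinuousOn.pow (ContinuousOn.div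
      continuousOn_const (by fun_prop) fun μ hμ => (hpos μ hμ i).ne') 2
  obtain ⟨μ, hμ, hφ⟩ : ∃ μ ∈ Set.Icc (min (1 - C) 1) 1,
      (∑ i, (c i / (e i + μ)) ^ 2 = ∑ i, c i ^ 2) := by
    rcases isEmpty_or_nonempty ι with hι | ⟨⟨i₀⟩⟩
    · exact ⟨1, by simp, by simp⟩
    have hC0 : 0 ≤ C := (he0 i₀).trans (heC i₀)
    rw [min_eq_left (by linarith)]
    refine intermediate_value_Icc' (by linarith) hcont ⟨?_, ?_⟩
    · refine Finset.sum_le_sum fun i _ => ?_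
      rw [div_pow]
      exact div_le_self (sq_nonneg _) (one_le_pow₀ (by linarith [he0 i]))
    · refine Finset.sum_le_sum fun i _ => ?_
      have hp := hpos (1 - C) ⟨le_rfl, by linarith⟩ i
      rw [div_pow]
      exact le_div_self (sq_nonneg _) (by positivity)
        (pow_le_one₀ hp.le (by linarith [heC i]))
  have hμ0 : 0 < μ := lt_of_lt_of_le (lt_min (by linarith) one_pos) hμ.1
  have hne (i : ι) : 0 < e i + μ := by linarith [he0 i]
  refine ⟨U *ᵥ fun i => c i / (e i + μ), μ, hμ0, hμ.2, ?_, ?_, ?_⟩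
  · rw [hmul, ← mulVec_smul, ← mulVec_add, ← hz]
    congr 1
    ext i
    have := (hne i).ne'
    simp only [Pi.add_apply, Pi.mul_apply, Pi.smul_apply, smul_eq_mul]
    field_simp
  · rw [hsq, hφ, ← hsq, hz]
  · rw [hquad, ← hz, hquad, Finset.mul_sum]
    refine Finset.sum_le_sum fun i _ => ?_
    have h2 : (e i + μ) ^ 2 ≤ (1 + C) ^ 2 :=
      pow_le_pow_left₀ (hne i).le (by linarith [heC i, hμ.2]) 2
    have h3 : c i ^ 2 = (e i + μ) ^ 2 * (c i / (e i + μ)) ^ 2 := by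
      have := (hne i).ne'
      field_simp
    rw [h3]
    have := mul_le_mul_of_nonneg_right h2
      (mul_nonneg (he0 i) (sq_nonneg (c i / (e i + μ))))
    linarith

end Matrix

namespace ModOne

theorem adj_comm {n k : ℕ} (i j : Fin n) : adj n k i j ↔ adj n k j i := by
  unfold adj
  rw [abs_sub_comm, ne_comm]

theorem lap_isSymm (n k : ℕ) : (lap n k).IsSymm := by
  ext i j
  by_cases h : i = j
  · subst h; rfl
  · simp [lap, h, Ne.symm h, adj_comm j i]

theorem lap_mulVec (n k : ℕ) (x : Fin n → ℝ) (i : Fin n) :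
    (lap n k).mulVec x i = ∑ j, if adj n k i j then x i - x j else 0 := by
  have h (j : Fin n) : lap n k i j * x j =
      (if i = j then (deg n k i : ℝ) * x i else 0) - if adj n k i j then x j else 0 := by
    by_cases hij : i = j
    · subst hij
      simp [lap, adj]
    · by_cases ha : adj n k i j <;> simp [lap, hij, ha]
  have h2 (j : Fin n) : (if adj n k i j then x i - x j else 0) =
      (if adj n k i j then x i else 0) - if adj n k i j then x j else 0 := by
    split_ifs <;> simp
  simp only [Matrix.mulVec, dotProduct, h, h2, Finset.sum_sub_distrib]
  simp [deg, ← Finset.sum_filter]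

/-- The Laplacian quadratic form as a sum over ordered pairs of adjacent vertices. -/
theorem two_mul_lap_quad (n k : ℕ) (x : Fin n → ℝ) :
    2 * ∑ i, x i * (lap n k).mulVec x i =
      ∑ i, ∑ j, if adj n k i j then (x i - x j) ^ 2 else 0 := by
  have h1 : ∑ i, x i * (lap n k).mulVec x i =
      ∑ i, ∑ j, if adj n k i j then x i * (x i - x j) else 0 := by
    simp only [lap_mulVec, Finset.mul_sum, mul_ite, mul_zero]
  have h2 : ∑ i, x i * (lap n k).mulVec x i =
      ∑ i, ∑ j, if adj n k i j then x j * (x j - x i) else 0 := by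
    rw [h1, Finset.sum_comm]
    simp only [adj_comm]
  rw [two_mul]
  nth_rewrite 1 [h1]
  rw [h2]
  simp only [← Finset.sum_add_distrib]
  refine Finset.sum_congr rfl fun i _ => Finset.sum_congr rfl fun j _ => ?_
  split_ifs
  · ring
  · simp

theorem lap_quad_nonneg (n k : ℕ) (x : Fin n → ℝ) : 0 ≤ ∑ i, x i * (lap n k).mulVec x i := by
  have h : 0 ≤ ∑ i, ∑ j, if adj n k i j then (x i - x j) ^ 2 else 0 :=
    Finset.sum_nonneg fun i _ => Finset.sum_nonneg fun j _ => by positivity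
  linarith [two_mul_lap_quad n k x]

/-- A sum over the neighbours of `i`, organised by the distance to `i`. -/
theorem sum_adj_eq (n k : ℕ) (i : Fin n) (F : ℕ → ℕ → ℝ) :
    (∑ j : Fin n, if adj n k i j then F (Nat.dist i j) j else 0) =
      ∑ d ∈ Finset.Icc 1 k, ((if (i : ℕ) + d < n then F d (i + d) else 0) +
        if d ≤ (i : ℕ) then F d (i - d) else 0) := by
  have hj (j : Fin n) : (if adj n k i j then F (Nat.dist i j) j else 0) =
      ∑ d ∈ Finset.Icc 1 k, ((if (j : ℕ) = i + d then F d j else 0) +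
        if (i : ℕ) = j + d then F d j else 0) := by
    have hd : ∀ d ∈ Finset.Icc 1 k, ((if (j : ℕ) = i + d then F d j else 0) +
        if (i : ℕ) = j + d then F d j else 0) =
        if Nat.dist i j = d then F d j else 0 := by
      intro d hd
      have hd1 := (Finset.mem_Icc.mp hd).1
      unfold Nat.dist
      split_ifs <;> first | omega | simp
    rw [Finset.sum_congr rfl hd, Finset.sum_ite_eq]
    refine if_congr ?_ rfl rfl
    rw [adj, Finset.mem_Icc, Nat.dist, ne_eq, Fin.ext_iff, abs_le]
    omega
  simp only [hj]
  rw [Finset.sum_comm]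
  refine Finset.sum_congr rfl fun d _ => ?_
  rw [Finset.sum_add_distrib]
  congr 1
  · split_ifs with h
    · rw [Finset.sum_eq_single ⟨i + d, h⟩]
      · simp
      · intro j _ hne
        exact if_neg fun h' => hne (Fin.ext h')
      · simp
    · exact Finset.sum_eq_zero fun j _ => if_neg (by omega)
  · split_ifs with h
    · rw [Finset.sum_eq_single ⟨i - d, by omega⟩]
      · simp [h]
      · intro j _ hne
        exact if_neg fun h' => hne (Fin.ext (by simp; omega))
      · simp
    · exact Finset.sum_eq_zero fun j _ => if_neg (by omega)

end ModOne

namespace ModOne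

/-- Every vertex has at most `2k` neighbours. -/
theorem sum_adj_le (n k : ℕ) (i : Fin n) :
    (∑ j : Fin n, if adj n k i j then (1 : ℝ) else 0) ≤ 2 * k := by
  rw [sum_adj_eq n k i fun _ _ => 1]
  calc _ ≤ ∑ d ∈ Finset.Icc 1 k, (2 : ℝ) := Finset.sum_le_sum fun d _ => by
        split_ifs <;> norm_num
    _ = 2 * k := by simp [mul_comm]

/-- The positive eigenvector of the signless Laplacian of a path, `sin ((q + 1/2) π / n)`. -/
def pathVec (n q : ℕ) : ℝ := Real.sin ((q + 1 / 2) * (Real.pi / n))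

theorem pathVec_pos {n q : ℕ} (hq : q < n) : 0 < pathVec n q := by
  have hn : (0 : ℝ) < n := by exact_mod_cast (Nat.zero_le q).trans_lt hq
  have hq' : (q : ℝ) + 1 ≤ n := by exact_mod_cast hq
  have hpi := Real.pi_pos
  refine Real.sin_pos_of_pos_of_lt_pi (by positivity) ?_
  rw [← mul_div_assoc, div_lt_iff₀ hn, mul_comm]
  exact mul_lt_mul_of_pos_left (by linarith) hpi

theorem pathVec_add_pathVec (n q : ℕ) :
    pathVec n (q + 2) + pathVec n q = 2 * Real.cos (Real.pi / n) * pathVec n (q + 1) := by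
  unfold pathVec
  set θ := Real.pi / n
  have h1 : ((q + 2 : ℕ) + 1 / 2 : ℝ) * θ = ((q + 1 : ℕ) + 1 / 2 : ℝ) * θ + θ := by
    push_cast; ring
  have h2 : ((q : ℕ) + 1 / 2 : ℝ) * θ = ((q + 1 : ℕ) + 1 / 2 : ℝ) * θ - θ := by
    push_cast; ring
  rw [h1, h2, Real.sin_add, Real.sin_sub]
  ring

theorem pathVec_one (n : ℕ) :
    pathVec n 1 = (2 * Real.cos (Real.pi / n) + 1) * pathVec n 0 := by
  unfold pathVec
  set θ := Real.pi / n
  have h1 : ((1 : ℕ) + 1 / 2 : ℝ) * θ = θ + θ / 2 := by push_cast; ring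
  have h2 : ((0 : ℕ) + 1 / 2 : ℝ) * θ = θ / 2 := by push_cast; ring
  have h3 : θ = 2 * (θ / 2) := by ring
  rw [h1, h2, Real.sin_add]
  have hc : Real.cos θ = 2 * Real.cos (θ / 2) ^ 2 - 1 := by rw [← Real.cos_two_mul, ← h3]
  have hs : Real.sin θ = 2 * Real.sin (θ / 2) * Real.cos (θ / 2) := by
    rw [← Real.sin_two_mul, ← h3]
  rw [hs, hc]
  ring

theorem pathVec_add_succ_nonneg {n q : ℕ} (hq : q < n) :
    0 ≤ pathVec n q + pathVec n (q + 1) := by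
  have hn1 : 1 ≤ n := by omega
  have hn : (1 : ℝ) ≤ n := by exact_mod_cast hn1
  have hq' : (q : ℝ) + 1 ≤ n := by exact_mod_cast hq
  have hpi := Real.pi_pos
  unfold pathVec
  set θ := Real.pi / n with hθ
  have hθ0 : 0 < θ := by positivity
  have hθpi : θ ≤ Real.pi := div_le_self hpi.le hn
  have h1 : ((q : ℕ) + 1 / 2 : ℝ) * θ = (q + 1) * θ - θ / 2 := by ring
  have h2 : ((q + 1 : ℕ) + 1 / 2 : ℝ) * θ = (q + 1) * θ + θ / 2 := by push_cast; ring
  rw [h1, h2, Real.sin_add, Real.sin_sub]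
  have h3 : 0 ≤ Real.sin ((q + 1) * θ) := by
    refine Real.sin_nonneg_of_nonneg_of_le_pi (by positivity) ?_
    rw [hθ, ← mul_div_assoc, div_le_iff₀ (by linarith), mul_comm]
    exact mul_le_mul_of_nonneg_left hq' hpi.le
  have h4 : 0 ≤ Real.cos (θ / 2) :=
    Real.cos_nonneg_of_neg_pi_div_two_le_of_le (by linarith) (by linarith)
  nlinarith [mul_nonneg h3 h4]

/-- The row bound for the graph joining vertices at distance exactly `d`, which is a disjoint
union of paths. -/
theorem pathVec_row_le {n d : ℕ} (hd : 1 ≤ d) (i : Fin n) :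
    ((if (i : ℕ) + d < n then 1 + pathVec n ((i + d) / d) / pathVec n (i / d) else 0) +
      if d ≤ (i : ℕ) then 1 + pathVec n ((i - d) / d) / pathVec n (i / d) else 0) ≤
      2 + 2 * Real.cos (Real.pi / n) := by
  have hi := i.isLt
  rw [Nat.add_div_right _ hd]
  have hqi : (i : ℕ) / d ≤ i := Nat.div_le_self _ _
  have hp : 0 < pathVec n (i / d) := pathVec_pos (hqi.trans_lt hi)
  have hcos : -1 ≤ Real.cos (Real.pi / n) := Real.neg_one_le_cos _
  rcases Nat.lt_or_ge (i : ℕ) d with h | h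
  · rw [if_neg (Nat.not_le.mpr h), Nat.div_eq_of_lt h] at *
    split_ifs
    · rw [pathVec_one, mul_div_assoc, div_self hp.ne']
      linarith
    · linarith
  · obtain ⟨q, hq⟩ : ∃ q, (i : ℕ) / d = q + 1 :=
      Nat.exists_eq_succ_of_ne_zero (Nat.div_pos h hd).ne'
    have hq' : ((i : ℕ) - d) / d = q := by
      have := Nat.add_div_right (i - d : ℕ) hd
      rw [Nat.sub_add_cancel h] at this
      omega
    rw [if_pos h, hq', hq]
    rw [hq] at hp hqi
    have hrec := pathVec_add_pathVec n q
    have hsum : pathVec n (q + 2) / pathVec n (q + 1) + pathVec n q / pathVec n (q + 1) =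
        2 * Real.cos (Real.pi / n) := by
      rw [← add_div, hrec, mul_div_assoc, div_self hp.ne', mul_one]
    split_ifs
    · change 1 + pathVec n (q + 2) / _ + _ ≤ _
      linarith
    · have hlast : 0 ≤ 1 + pathVec n (q + 2) / pathVec n (q + 1) := by
        have := div_nonneg (pathVec_add_succ_nonneg (n := n) (q := q + 1) (by omega)) hp.le
        rwa [add_div, div_self hp.ne'] at this
      linarith

/-- The largest Laplacian eigenvalue of the path-power graph is at most
`4k - 4k sin² (π / (2n))`. -/
theorem lap_quad_le {n : ℕ} (k : ℕ) (x : Fin n → ℝ) :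
    ∑ i, x i * (lap n k).mulVec x i ≤
      (4 * k - 4 * k * Real.sin (Real.pi / (2 * n)) ^ 2) * ∑ i, x i ^ 2 := by
  set P : ℕ → ℕ → ℝ := fun d i => pathVec n (i / d)
  have hP (d : ℕ) (i : Fin n) : 0 < P d i :=
    pathVec_pos ((Nat.div_le_self _ _).trans_lt i.isLt)
  set w : Fin n → Fin n → ℝ := fun i j => 1 + P (Nat.dist i j) j / P (Nat.dist i j) i
  have hpair (i j : Fin n) : (x i - x j) ^ 2 ≤ x i ^ 2 * w i j + x j ^ 2 * w j i := by
    simp only [w, Nat.dist_comm j i]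
    have hi := hP (Nat.dist i j) i
    have hj := hP (Nat.dist i j) j
    set a := P (Nat.dist i j) i
    set b := P (Nat.dist i j) j
    have : x i ^ 2 * (1 + b / a) + x j ^ 2 * (1 + a / b) - (x i - x j) ^ 2 =
        (b * x i + a * x j) ^ 2 / (a * b) := by
      field_simp
      ring
    have h2 : 0 ≤ (b * x i + a * x j) ^ 2 / (a * b) := by positivity
    linarith
  have hrow (i : Fin n) : (∑ j, if adj n k i j then w i j else 0) ≤
      4 * k - 4 * k * Real.sin (Real.pi / (2 * n)) ^ 2 := by
    simp only [w]
    rw [sum_adj_eq n k i fun d j => 1 + P d j / P d i]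
    have hcos : Real.cos (Real.pi / n) = 1 - 2 * Real.sin (Real.pi / (2 * n)) ^ 2 := by
      have : Real.pi / n = 2 * (Real.pi / (2 * n)) := by field_simp
      rw [this, Real.cos_two_mul, Real.cos_sq']
      ring
    refine (Finset.sum_le_sum fun d hd =>
      pathVec_row_le (Finset.mem_Icc.mp hd).1 i).trans_eq ?_
    rw [Finset.sum_const, Nat.card_Icc, hcos, nsmul_eq_mul]
    simp only [Nat.add_sub_cancel]
    ring
  have hS : ∑ i, ∑ j, (if adj n k i j then x i ^ 2 * w i j else 0) ≤
      (4 * k - 4 * k * Real.sin (Real.pi / (2 * n)) ^ 2) * ∑ i, x i ^ 2 := by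
    rw [Finset.mul_sum]
    refine Finset.sum_le_sum fun i _ => ?_
    have := mul_le_mul_of_nonneg_left (hrow i) (sq_nonneg (x i))
    simp only [Finset.mul_sum, mul_ite, mul_zero] at this
    linarith
  have hS' : ∑ i, ∑ j, (if adj n k i j then x i ^ 2 * w i j else 0) =
      ∑ i, ∑ j, (if adj n k i j then x j ^ 2 * w j i else 0) := by
    rw [Finset.sum_comm]
    simp only [adj_comm]
  have hle : ∑ i, ∑ j, (if adj n k i j then (x i - x j) ^ 2 else 0) ≤
      ∑ i, ∑ j, (if adj n k i j then x i ^ 2 * w i j else 0) +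
      ∑ i, ∑ j, (if adj n k i j then x j ^ 2 * w j i else 0) := by
    simp only [← Finset.sum_add_distrib]
    refine Finset.sum_le_sum fun i _ => Finset.sum_le_sum fun j _ => ?_
    split_ifs
    · exact hpair i j
    · simp
  linarith [two_mul_lap_quad n k x]

theorem Hmat_isHermitian (n k : ℕ) (lam : ℝ) : (Hmat n k lam).IsHermitian := by
  have h : (lam • lap n k).IsHermitian := by
    rw [Matrix.IsHermitian, Matrix.conjTranspose_eq_transpose_of_trivial, Matrix.transpose_smul,
      lap_isSymm]
  exact Matrix.IsHermitian.fromBlocks h (by simp) h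

theorem quad_Hmat (n k : ℕ) (lam : ℝ) (v : Fin n ⊕ Fin n → ℝ) :
    quad n (Hmat n k lam) v =
      lam * (∑ i, v (Sum.inl i) * (lap n k).mulVec (v ∘ Sum.inl) i +
        ∑ i, v (Sum.inr i) * (lap n k).mulVec (v ∘ Sum.inr) i) := by
  simp only [quad, Hmat, Matrix.fromBlocks_mulVec, Fintype.sum_sum_type, Sum.elim_inl,
    Sum.elim_inr, Matrix.zero_mulVec, Matrix.smul_mulVec,
    Pi.smul_apply, smul_eq_mul, add_zero, zero_add, mul_add, Finset.mul_sum]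
  congr 1 <;> exact Finset.sum_congr rfl fun i _ => by ring

theorem cvec_sq (n : ℕ) (t : Fin n → ℝ) : ∑ i, cvec n t i ^ 2 = n := by
  have h (i : Fin n) : (circ (t i)).re ^ 2 + (circ (t i)).im ^ 2 = 1 := by
    have h1 : ‖circ (t i)‖ = 1 := by
      have : circ (t i) = Complex.exp ((2 * Real.pi * t i : ℝ) * Complex.I) := by
        unfold circ; push_cast; ring_nf
      rw [this, Complex.norm_exp_ofReal_mul_I]
    have h2 := Complex.normSq_apply (circ (t i))
    rw [Complex.normSq_eq_norm_sq, h1] at h2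
    linarith
  simp only [Fintype.sum_sum_type, cvec, embed, Sum.elim_inl, Sum.elim_inr,
    ← Finset.sum_add_distrib, h]
  simp

theorem circ_sub_sq_le (a b : ℝ) :
    ((circ a).re - (circ b).re) ^ 2 + ((circ a).im - (circ b).im) ^ 2 ≤
      (2 * Real.pi) ^ 2 * |a - b| ^ 2 := by
  have h1 : ‖circ a - circ b‖ ≤ 2 * Real.pi * |a - b| := by
    have : circ a - circ b = Complex.exp ((2 * Real.pi * b : ℝ) * Complex.I) *
        (Complex.exp (Complex.I * (2 * Real.pi * (a - b) : ℝ)) - 1) := by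
      rw [mul_sub, ← Complex.exp_add]
      unfold circ
      push_cast
      ring_nf
    rw [this, norm_mul, Complex.norm_exp_ofReal_mul_I, one_mul]
    refine Real.norm_exp_I_mul_ofReal_sub_one_le.trans_eq ?_
    rw [Real.norm_eq_abs, abs_mul, abs_of_pos Real.two_pi_pos]
  have h2 := Complex.normSq_apply (circ a - circ b)
  rw [Complex.normSq_eq_norm_sq, Complex.sub_re, Complex.sub_im] at h2
  have h3 := pow_le_pow_left₀ (norm_nonneg _) h1 2
  rw [mul_pow] at h3
  linarith

/-- The smoothness of the embedded vector of samples of `u`, when neighbouring samples differ by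
at most `B`. -/
theorem quad_Hmat_cvec_le (n k : ℕ) {lam B : ℝ} (hlam : 0 ≤ lam) (u : Fin n → ℝ)
    (hu : ∀ i j, adj n k i j → |u i - u j| ≤ B) :
    quad n (Hmat n k lam) (cvec n u) ≤ lam * (n * k * ((2 * Real.pi) ^ 2 * B ^ 2)) := by
  rw [quad_Hmat]
  refine mul_le_mul_of_nonneg_left ?_ hlam
  have h1 := two_mul_lap_quad n k (cvec n u ∘ Sum.inl)
  have h2 := two_mul_lap_quad n k (cvec n u ∘ Sum.inr)
  simp only [Function.comp_apply] at h1 h2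
  have h3 : ∑ i, ∑ j, (if adj n k i j then
        (cvec n u (Sum.inl i) - cvec n u (Sum.inl j)) ^ 2 else 0) +
      ∑ i, ∑ j, (if adj n k i j then
        (cvec n u (Sum.inr i) - cvec n u (Sum.inr j)) ^ 2 else 0) ≤
      ∑ _i : Fin n, (2 * k) * ((2 * Real.pi) ^ 2 * B ^ 2) := by
    simp only [← Finset.sum_add_distrib]
    refine Finset.sum_le_sum fun i _ => ?_
    refine le_trans ?_ (mul_le_mul_of_nonneg_right (sum_adj_le n k i) (by positivity))
    rw [Finset.sum_mul]
    refine Finset.sum_le_sum fun j _ => ?_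
    split_ifs with h
    · rw [one_mul]
      refine (circ_sub_sq_le (u i) (u j)).trans ?_
      gcongr
      exact hu i j h
    · simp
  rw [Finset.sum_const, Finset.card_univ, Fintype.card_fin, nsmul_eq_mul] at h3
  linarith

end ModOne

namespace ModOne

theorem abs_gridPt_sub_le {n k : ℕ} (hn : 2 ≤ n) {i j : Fin n} (h : adj n k i j) :
    |gridPt n i - gridPt n j| ≤ 2 * k / n := by
  have hn' : (2 : ℝ) ≤ n := by exact_mod_cast hn
  have h1 : |(i : ℝ) - (j : ℝ)| ≤ k := by exact_mod_cast h.2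
  rw [gridPt, gridPt, ← sub_div, abs_div, abs_of_pos (by linarith : (0 : ℝ) < n - 1),
    div_le_div_iff₀ (by linarith) (by linarith)]
  have hk : (0 : ℝ) ≤ k := k.cast_nonneg
  calc _ ≤ (k : ℝ) * n := mul_le_mul_of_nonneg_right h1 (by linarith)
    _ ≤ _ := by nlinarith

theorem gridPt_mem {n : ℕ} (hn : 2 ≤ n) (i : Fin n) : gridPt n i ∈ Set.Icc (0 : ℝ) 1 := by
  have hn' : (2 : ℝ) ≤ n := by exact_mod_cast hn
  have hi : (i : ℝ) + 1 ≤ n := by exact_mod_cast i.isLt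
  exact ⟨div_nonneg (Nat.cast_nonneg _) (by linarith),
    (div_le_one (by linarith)).mpr (by linarith)⟩

/-- The smoothness of the embedded vector of grid samples of a Hölder function. -/
theorem quad_Hmat_holder_le {n k : ℕ} (hn : 2 ≤ n) (hk : 1 ≤ k) {lam : ℝ} (hlam : 0 ≤ lam)
    {f : ℝ → ℝ} {M α : ℝ} (hM : 0 < M) (hα : 0 < α)
    (hf : ∀ x ∈ Set.Icc (0 : ℝ) 1, ∀ y ∈ Set.Icc (0 : ℝ) 1, |f x - f y| ≤ M * |x - y| ^ α) :
    quad n (Hmat n k lam) (cvec n fun i => f (gridPt n i)) ≤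
      2 * n * (lam * Real.pi ^ 2 * M ^ 2 * (2 * (k : ℝ)) ^ (2 * α + 1) / (n : ℝ) ^ (2 * α)) := by
  have hn0 : (0 : ℝ) < n := by exact_mod_cast (by omega : 0 < n)
  have hk0 : (0 : ℝ) < k := by exact_mod_cast hk
  refine (quad_Hmat_cvec_le n k (B := M * (2 * k / n) ^ α) hlam _
    fun i j h => (hf _ (gridPt_mem hn i) _ (gridPt_mem hn j)).trans ?_).trans_eq ?_
  · gcongr
    exact abs_gridPt_sub_le hn h
  · have h1 : ((2 * k / n : ℝ) ^ α) ^ 2 = (2 * k) ^ (2 * α) / (n : ℝ) ^ (2 * α) := by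
      rw [← Real.div_rpow (by positivity) hn0.le, mul_comm 2 α,
        Real.rpow_mul (by positivity), Real.rpow_two]
    rw [mul_pow M, h1, Real.rpow_add (by positivity), Real.rpow_one]
    ring

/-- The growth of the objective on the sphere around a stationary point with multiplier `μ`. -/
theorem objective_sub_eq {n k : ℕ} {lam μ : ℝ} {z g g' : Fin n ⊕ Fin n → ℝ}
    (hg : (Hmat n k lam).mulVec g + μ • g = z) (hgg : g' ⬝ᵥ g' = g ⬝ᵥ g) :
    objective n k lam z g' - objective n k lam z g =
      (g' - g) ⬝ᵥ (Hmat n k lam).mulVec (g' - g) + μ * ((g' - g) ⬝ᵥ (g' - g)) := by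
  change g' ⬝ᵥ (Hmat n k lam).mulVec g' - 2 * (g' ⬝ᵥ z) -
    (g ⬝ᵥ (Hmat n k lam).mulVec g - 2 * (g ⬝ᵥ z)) = _
  have hs : g ⬝ᵥ (Hmat n k lam).mulVec g' = g' ⬝ᵥ (Hmat n k lam).mulVec g := by
    rw [Matrix.dotProduct_mulVec, ← Matrix.mulVec_transpose,
      ← Matrix.conjTranspose_eq_transpose_of_trivial, Hmat_isHermitian, dotProduct_comm]
  simp only [← hg, Matrix.mulVec_sub, sub_dotProduct, dotProduct_sub, dotProduct_add,
    dotProduct_smul, smul_eq_mul, hs, hgg, dotProduct_comm g g']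
  ring

end ModOne

open ModOne in
/-- Assume `n ≥ 2` and `‖z̄ − h̄‖₂ ≤ δ√n` for some `δ ∈ [0,1]`. If `z̄` is
orthogonal to `N(H)` and `λ < 1/(4k)`, then (TRS) has a unique global minimizer `ĝ`, and it
satisfies `(1/n)⟨h̄, ĝ⟩ ≥ 1 − 3δ/2 − λπ²M²(2k)^{2α+1}/n^{2α}
+ (1/(1 + 4λk − 4λk·sin²(π/(2n)))²)·(1/(2n))·z̄ᵀHz̄`. -/
theorem statement7 (n k : ℕ) (hn : 2 ≤ n) (hk₁ : 1 ≤ k) (hk₂ : k ≤ n - 1)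
    (lam : ℝ) (hlam : 0 ≤ lam) (hlam' : lam < 1 / (4 * (k:ℝ)))
    (f : ℝ → ℝ) (M α : ℝ) (hM : 0 < M) (hα : α ∈ Set.Ioc (0:ℝ) 1)
    (hf : ∀ x ∈ Set.Icc (0:ℝ) 1, ∀ y ∈ Set.Icc (0:ℝ) 1, |f x - f y| ≤ M * |x - y| ^ α)
    (y : Fin n → ℝ) (hy : ∀ i, y i ∈ Set.Ico (0:ℝ) 1)
    (δ : ℝ) (hδ : δ ∈ Set.Icc (0:ℝ) 1)
    (hnoise : norm2 n (cvec n y - cvec n (fun i => f (gridPt n i))) ≤ δ * Real.sqrt n)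
    (hperp : perpNull n k lam (cvec n y)) :
    ∃ g, minimizer n k lam (cvec n y) g ∧
      (∀ g', minimizer n k lam (cvec n y) g' → g' = g) ∧
      (1 / (n:ℝ)) * dotR n (cvec n (fun i => f (gridPt n i))) g ≥
        1 - 3 * δ / 2
          - lam * Real.pi ^ 2 * M ^ 2 * (2 * (k:ℝ)) ^ (2 * α + 1) / (n:ℝ) ^ (2 * α)
          + (1 / (1 + 4 * lam * (k:ℝ)
                - 4 * lam * (k:ℝ) * Real.sin (Real.pi / (2 * (n:ℝ))) ^ 2) ^ 2) *
              ((1 / (2 * (n:ℝ))) * quad n (Hmat n k lam) (cvec n y)) := by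
  have hn0 : (0 : ℝ) < n := by exact_mod_cast (by omega : 0 < n)
  have hk0 : (0 : ℝ) < k := by exact_mod_cast hk₁
  set s := Real.sin (Real.pi / (2 * (n:ℝ))) ^ 2
  set z := cvec n y
  set u := cvec n (fun i => f (gridPt n i)) with hu
  set C := lam * (4 * k - 4 * k * s) with hC
  have hs0 : 0 ≤ s := sq_nonneg _
  have hlamk : lam * (4 * k) < 1 := by rwa [lt_div_iff₀ (by positivity)] at hlam'
  have hC1 : C < 1 := by
    have : 0 ≤ lam * (4 * k * s) := by positivity
    rw [hC, mul_sub]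
    linarith
  have hC0 : 0 ≤ C := by
    have : 4 * (k : ℝ) * s ≤ 4 * k * 1 := by
      gcongr
      exact Real.sin_sq_le_one _
    exact mul_nonneg hlam (by linarith)
  have hdot (v : Fin n ⊕ Fin n → ℝ) : v ⬝ᵥ v = ∑ i, v i ^ 2 :=
    Finset.sum_congr rfl fun i _ => (sq (v i)).symm
  have hpsd (v : Fin n ⊕ Fin n → ℝ) : 0 ≤ v ⬝ᵥ (Hmat n k lam).mulVec v := by
    refine le_of_le_of_eq ?_ (quad_Hmat n k lam v).symm
    exact mul_nonneg hlam (add_nonneg (lap_quad_nonneg n k _) (lap_quad_nonneg n k _))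
  have hbdd (v : Fin n ⊕ Fin n → ℝ) : v ⬝ᵥ (Hmat n k lam).mulVec v ≤ C * (v ⬝ᵥ v) := by
    refine (quad_Hmat n k lam v).trans_le ?_
    rw [hdot, Fintype.sum_sum_type, hC, mul_assoc, mul_add (4 * (k : ℝ) - 4 * k * s)]
    exact mul_le_mul_of_nonneg_left
      (add_le_add (lap_quad_le k (v ∘ Sum.inl)) (lap_quad_le k (v ∘ Sum.inr))) hlam
  obtain ⟨g, μ, hμ, -, hstat, hnorm, hquad⟩ :=
    (Hmat n k lam).exists_trustRegion_solution (Hmat_isHermitian n k lam) hC1 hpsd hbdd z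
  have hzn : ∑ i, z i ^ 2 = n := cvec_sq n y
  have hun : ∑ i, u i ^ 2 = n := cvec_sq n _
  have hgn : ∑ i, g i ^ 2 = n := by rw [← hdot, hnorm, hdot, hzn]
  have hgrow (g' : Fin n ⊕ Fin n → ℝ) (hg' : feasible n g') :
      μ * ((g' - g) ⬝ᵥ (g' - g)) ≤ objective n k lam z g' - objective n k lam z g := by
    rw [objective_sub_eq hstat (by rw [hdot, hdot, hgn]; exact hg')]
    linarith [hpsd (g' - g)]
  have hsqn (v : Fin n ⊕ Fin n → ℝ) : 0 ≤ v ⬝ᵥ v := by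
    rw [hdot]
    exact Finset.sum_nonneg fun i _ => sq_nonneg _
  have hmin (g' : Fin n ⊕ Fin n → ℝ) (hg' : feasible n g') :
      objective n k lam z g ≤ objective n k lam z g' := by
    linarith [hgrow g' hg', mul_nonneg hμ.le (hsqn (g' - g))]
  refine ⟨g, ⟨hgn, hmin⟩, fun g' hg' => ?_, ?_⟩
  · have h1 := hgrow g' hg'.1
    have h2 := hg'.2 g hgn
    have h3 : (g' - g) ⬝ᵥ (g' - g) ≤ 0 :=
      nonpos_of_mul_nonpos_right (h1.trans (by linarith)) hμ
    exact sub_eq_zero.mp (dotProduct_self_eq_zero.mp (le_antisymm h3 (hsqn _)))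
  have hδ0 := hδ.1
  have hdist : ∑ i, (z - u) i ^ 2 ≤ δ ^ 2 * n := by
    have h1 := pow_le_pow_left₀ (Real.sqrt_nonneg _) hnoise 2
    rwa [Real.sq_sqrt (Finset.sum_nonneg fun i _ => sq_nonneg _), mul_pow,
      Real.sq_sqrt hn0.le] at h1
  have huz : n * (1 - δ / 2) ≤ u ⬝ᵥ z := by
    have h1 : ∑ i, (z - u) i ^ 2 = n + n - 2 * (u ⬝ᵥ z) := by
      rw [← hdot, sub_dotProduct, dotProduct_sub, dotProduct_sub, dotProduct_comm z u, hdot, hdot,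
        hzn, hun]
      ring
    have h2 : δ ^ 2 * n ≤ δ * n := by
      gcongr
      nlinarith [hδ.2]
    linarith
  have hcs : (z - u) ⬝ᵥ g ≤ δ * n := by
    refine le_of_abs_le (abs_le_of_sq_le_sq ?_ (by positivity))
    calc ((z - u) ⬝ᵥ g) ^ 2 ≤ (∑ i, (z - u) i ^ 2) * ∑ i, g i ^ 2 :=
          Finset.sum_mul_sq_le_sq_mul_sq _ _ _
      _ ≤ (δ ^ 2 * n) * n := by rw [hgn]; gcongr
      _ = _ := by ring
  have hobj : g ⬝ᵥ (Hmat n k lam).mulVec g - 2 * (g ⬝ᵥ z) ≤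
      quad n (Hmat n k lam) u - 2 * (u ⬝ᵥ z) := hmin u hun
  have hsmooth := quad_Hmat_holder_le hn hk₁ hlam hM hα.1 hf
  rw [← hu] at hsmooth
  set R := lam * Real.pi ^ 2 * M ^ 2 * (2 * (k:ℝ)) ^ (2 * α + 1) / (n:ℝ) ^ (2 * α)
  have hCden : 1 + 4 * lam * (k:ℝ) - 4 * lam * (k:ℝ) * s = 1 + C := by rw [hC]; ring
  rw [hCden, ge_iff_le]
  change _ ≤ 1 / (n : ℝ) * (u ⬝ᵥ g)
  have hq : 1 / (1 + C) ^ 2 * quad n (Hmat n k lam) z ≤ g ⬝ᵥ (Hmat n k lam).mulVec g := by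
    rw [one_div_mul_eq_div, div_le_iff₀' (by positivity)]
    exact hquad
  rw [sub_dotProduct, dotProduct_comm z g] at hcs
  have hmain : n * (1 - 3 * δ / 2 - R) +
      1 / (1 + C) ^ 2 * quad n (Hmat n k lam) z / 2 ≤ u ⬝ᵥ g := by linarith
  calc _ = 1 / (n : ℝ) * (n * (1 - 3 * δ / 2 - R) +
      1 / (1 + C) ^ 2 * quad n (Hmat n k lam) z / 2) := by field_simp
    _ ≤ _ := by gcongr
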